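/- Let M be a free N-pseudospace, A a closed subset of M and X a finite subset of M. Then cl(A ∪ X) \ A is finite. -/

import Mathlib

/-- A *zigzag* of length `n`: consecutive terms are strictly comparable and every
interior term is either the infimum (a sink) or the supremum (a peak) of its two
neighbours. -/
def IsZigzag {V : Type*} [Lattice V] (x : ℕ → V) (n : ℕ) : Prop :=
  (∀ i < n, x i < x (i + 1) ∨ x (i + 1) < x i) ∧
  ∀ i, i + 2 ≤ n →
    (x (i + 1) < x i ∧ x (i + 1) < x (i + 2) ∧ x (i + 1) = x i ⊓ x (i + 2)) ∨
    (x i < x (i + 1) ∧ x (i + 2) < x (i + 1) ∧ x (i + 1) = x i ⊔ x (i + 2))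

/-- A *zigzag cycle* of length `2 * n`: a `2 * n`-periodic sequence satisfying the
zigzag condition at every index (i.e. indices modulo `2 * n`). -/
def IsZigzagCycle {V : Type*} [Lattice V] (x : ℕ → V) (n : ℕ) : Prop :=
  0 < n ∧ (∀ i, x (i + 2 * n) = x i) ∧
  ∀ i,
    (x (i + 1) < x i ∧ x (i + 1) < x (i + 2) ∧ x (i + 1) = x i ⊓ x (i + 2)) ∨
    (x i < x (i + 1) ∧ x (i + 2) < x (i + 1) ∧ x (i + 1) = x i ⊔ x (i + 2))

/-- A lattice is *simply connected* if it contains no zigzag cycles. -/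
def SimplyConnected (V : Type*) [Lattice V] : Prop :=
  ∀ (x : ℕ → V) (n : ℕ), ¬IsZigzagCycle x n

/-- A *free N-pseudospace* structure on a bounded lattice `M`: an `N`-geometry
(layers indexed by `-1, …, N+1` via the function `layer`, strictly monotone,
with `⊥` in layer `-1` and `⊤` in layer `N+1`) which is simply connected and such
that for all `a < b` and every layer index `s` strictly between the layers of `a`
and `b` there are infinitely many `x` in layer `s` with `a < x < b`. -/
structure FreePseudospace (N : ℕ) (M : Type*) [Lattice M] [BoundedOrder M] where
  layer : M → ℤ
  layer_bot : layer ⊥ = -1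
  layer_top : layer ⊤ = (N : ℤ) + 1
  layer_bounds : ∀ v : M, -1 ≤ layer v ∧ layer v ≤ (N : ℤ) + 1
  layer_strictMono : ∀ v w : M, v < w → layer v < layer w
  simplyConnected : SimplyConnected M
  dense_layers : ∀ a b : M, a < b → ∀ s : ℤ, layer a < s → s < layer b →
    {x : M | a < x ∧ x < b ∧ layer x = s}.Infinite

/-- A subset `A` is *closed* if it contains `⊥` and `⊤` and every zigzag whose two
endpoints lie in `A` lies entirely in `A`. -/
def ZClosed {M : Type*} [Lattice M] [BoundedOrder M] (A : Set M) : Prop :=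
  ⊥ ∈ A ∧ ⊤ ∈ A ∧
  ∀ (x : ℕ → M) (n : ℕ), IsZigzag x n → x 0 ∈ A → x n ∈ A → ∀ i ≤ n, x i ∈ A

/-- A *direct path* from `x 0` to `A`: a zigzag `x 0, …, x n` with `x i ∉ A` for
`i < n`, `x n ∈ A`, and no element of `A` strictly between `x (n-1)` and `x n`. -/
def IsDirectPath {M : Type*} [Lattice M] (x : ℕ → M) (n : ℕ) (A : Set M) : Prop :=
  IsZigzag x n ∧ (∀ i < n, x i ∉ A) ∧ x n ∈ A ∧
  ∀ y ∈ A, ¬((x (n - 1) < y ∧ y < x n) ∨ (x n < y ∧ y < x (n - 1)))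

/-- The *closure* `zcl X`: the smallest closed subset containing `X`. -/
def zcl {M : Type*} [Lattice M] [BoundedOrder M] (X : Set M) : Set M :=
  ⋂₀ {A : Set M | ZClosed A ∧ X ⊆ A}

/-- `b` is a sink or a peak between `a` and `c`. -/
def IsTurn {V : Type*} [Lattice V] (a b c : V) : Prop :=
  (b < a ∧ b < c ∧ b = a ⊓ c) ∨ (a < b ∧ c < b ∧ b = a ⊔ c)

/-- Prepend a term to a sequence. -/
def seqCons {V : Type*} (a : V) (x : ℕ → V) : ℕ → V
  | 0 => a
  | i + 1 => x i

section Zigzag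

variable {V : Type*} [Lattice V] {x : ℕ → V} {n : ℕ}

theorem IsTurn.symm {a b c : V} (h : IsTurn a b c) : IsTurn c b a := by
  rcases h with ⟨h₁, h₂, h₃⟩ | ⟨h₁, h₂, h₃⟩
  · exact Or.inl ⟨h₂, h₁, by rw [inf_comm]; exact h₃⟩
  · exact Or.inr ⟨h₂, h₁, by rw [sup_comm]; exact h₃⟩

theorem IsTurn.left_lt_iff {a b c : V} (h : IsTurn a b c) : a < b ↔ c < b := by
  rcases h with ⟨h₁, h₂, -⟩ | ⟨h₁, h₂, -⟩
  · exact ⟨fun h => absurd h h₁.not_gt, fun h => absurd h h₂.not_gt⟩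
  · exact ⟨fun _ => h₂, fun _ => h₁⟩

theorem IsTurn.eq_sup {a b c : V} (h : IsTurn a b c) (hab : a < b) : b = a ⊔ c := by
  rcases h with ⟨h₁, -, -⟩ | ⟨-, -, h₃⟩
  · exact absurd hab h₁.not_gt
  · exact h₃

theorem IsTurn.eq_inf {a b c : V} (h : IsTurn a b c) (hab : b < a) : b = a ⊓ c := by
  rcases h with ⟨-, -, h₃⟩ | ⟨h₁, -, -⟩
  · exact h₃
  · exact absurd hab h₁.not_gt

theorem IsTurn.right_lt {a b c : V} (h : IsTurn a b c) (hab : a < b) : c < b :=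
  h.left_lt_iff.1 hab

theorem IsTurn.lt_right {a b c : V} (h : IsTurn a b c) (hab : b < a) : b < c := by
  rcases h with ⟨-, h₂, -⟩ | ⟨h₁, -, -⟩
  · exact h₂
  · exact absurd hab h₁.not_gt

/-- A peak remains a peak when its lower left neighbour is raised. -/
theorem IsTurn.raise_left {a b c d : V} (h : IsTurn a b c) (had : a ≤ d) (hdb : d < b) :
    IsTurn d b c := by
  have hab := had.trans_lt hdb
  refine Or.inr ⟨hdb, h.right_lt hab, le_antisymm ?_ (sup_le hdb.le (h.right_lt hab).le)⟩
  conv_lhs => rw [h.eq_sup hab]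
  exact sup_le_sup_right had c

theorem IsZigzag.step (h : IsZigzag x n) {i : ℕ} (hi : i < n) :
    x i < x (i + 1) ∨ x (i + 1) < x i := h.1 i hi

theorem IsZigzag.turn (h : IsZigzag x n) {i : ℕ} (hi : i + 2 ≤ n) :
    IsTurn (x i) (x (i + 1)) (x (i + 2)) := h.2 i hi

theorem IsZigzag.shift (h : IsZigzag x n) {j k : ℕ} (hk : j + k ≤ n) :
    IsZigzag (fun i => x (j + i)) k :=
  ⟨fun i hi => h.1 (j + i) (by omega), fun i hi => h.2 (j + i) (by omega)⟩

theorem IsZigzag.reverse (h : IsZigzag x n) : IsZigzag (fun i => x (n - i)) n := by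
  refine ⟨fun i hi => ?_, fun i hi => ?_⟩
  · have e : n - i = n - (i + 1) + 1 := by omega
    have := h.step (i := n - (i + 1)) (by omega)
    rw [← e] at this
    exact this.symm
  · have := (h.turn (i := n - (i + 2)) (by omega)).symm
    rwa [show n - (i + 2) + 2 = n - i by omega,
      show n - (i + 2) + 1 = n - (i + 1) by omega] at this

theorem IsZigzag.cons (h : IsZigzag x n) {a : V} (hs : a < x 0 ∨ x 0 < a)
    (ht : 1 ≤ n → IsTurn a (x 0) (x 1)) : IsZigzag (seqCons a x) (n + 1) := by
  refine ⟨fun i hi => ?_, fun i hi => ?_⟩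
  · cases i with
    | zero => exact hs
    | succ i => exact h.1 i (by omega)
  · cases i with
    | zero => exact ht (by omega)
    | succ i => exact h.2 i (by omega)

/-- The first term of a zigzag going up may be raised. -/
theorem IsZigzag.raise_head (h : IsZigzag x n) {d : V} (hn : 1 ≤ n) (h₀ : x 0 ≤ d)
    (h₁ : d < x 1) : IsZigzag (seqCons d fun i => x (1 + i)) n := by
  obtain ⟨m, rfl⟩ : ∃ m, n = m + 1 := ⟨n - 1, by omega⟩
  exact (h.shift (j := 1) (k := m) (by omega)).cons (Or.inl h₁)
    fun hm => (h.turn (i := 0) (by omega)).raise_left h₀ h₁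

open OrderDual in
theorem IsZigzag.dual (h : IsZigzag x n) : IsZigzag (fun i => toDual (x i)) n :=
  ⟨fun i hi => (h.1 i hi).symm, fun i hi => (h.2 i hi).symm⟩

open OrderDual in
theorem SimplyConnected.dual (h : SimplyConnected V) : SimplyConnected Vᵒᵈ :=
  fun y m hy => h (fun i => ofDual (y i)) m ⟨hy.1, hy.2.1, fun i => (hy.2.2 i).symm⟩

theorem IsZigzag.lt_succ_iff_even (h : IsZigzag x n) (h₀ : x 0 < x 1) :
    ∀ i < n, (x i < x (i + 1) ↔ Even i) := by
  intro i
  induction i with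
  | zero => exact fun _ => ⟨fun _ => Even.zero, fun _ => h₀⟩
  | succ i ih =>
    intro hi
    rw [Nat.even_add_one, ← ih (by omega), (h.turn (i := i) (by omega)).left_lt_iff]
    exact ⟨fun h => h.not_gt, (h.step hi).resolve_right⟩

theorem SimplyConnected.not_isTurn (hV : SimplyConnected V) (h : IsZigzag x n) (hn : 2 ≤ n)
    (he : Even n) (hc : x 0 = x n) : ¬ IsTurn (x (n - 1)) (x 0) (x 1) := by
  intro ht
  obtain ⟨m, hm⟩ := he
  refine hV (fun i => x (i % n)) m ⟨by omega, fun i => ?_, fun i => ?_⟩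
  · simp [show i + 2 * m = i + n by omega]
  · change IsTurn (x (i % n)) (x ((i + 1) % n)) (x ((i + 2) % n))
    have hr : i % n < n := Nat.mod_lt _ (by omega)
    rw [Nat.add_mod i 1, Nat.add_mod i 2]
    generalize i % n = r at hr
    rw [Nat.mod_eq_of_lt (show 1 < n by omega)]
    rcases Nat.lt_or_ge (r + 1) n with h₁ | h₁
    · rw [Nat.mod_eq_of_lt h₁]
      have key := h.turn (i := r) (by omega)
      rw [Nat.add_mod_mod]
      rcases Nat.lt_or_ge (r + 2) n with h₂ | h₂
      · rwa [Nat.mod_eq_of_lt h₂]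
      · obtain rfl : n = r + 2 := by omega
        rwa [Nat.mod_self, hc]
    · obtain rfl : n = r + 1 := by omega
      rw [Nat.mod_self, Nat.add_mod_mod, show r + 2 = 1 + (r + 1) by omega, Nat.add_mod_right,
        Nat.mod_eq_of_lt (by omega)]
      exact ht

/-- Inductive step for `SimplyConnected.not_closed`: both neighbours of the base point lie
above it. -/
theorem SimplyConnected.not_closed_turn (hV : SimplyConnected V) (h : IsZigzag x n)
    (hn : 2 ≤ n) (hc : x 0 = x n)
    (ih : ∀ m, 1 ≤ m → m < n → ∀ y : ℕ → V, IsZigzag y m → y 0 ≠ y m)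
    (h₀ : x 0 < x 1) (h₁ : x n < x (n - 1)) : False := by
  have hn2 : n ≠ 2 := by
    rintro rfl
    have := (h.turn (i := 0) le_rfl).eq_sup h₀
    simp only [Nat.zero_add, ← hc, sup_idem] at this
    exact h₀.ne' this
  have aux : ∀ y : ℕ → V, IsZigzag y n → y 0 < y 1 → y 0 = y n → ¬ y 1 < y (n - 1) := by
    intro y hy hy₀ hyc hlt
    have hr : IsZigzag (seqCons (y 1) fun i => y (n - (1 + i))) n :=
      hy.reverse.raise_head (d := y 1) (by omega)
        (by simpa [← hyc] using hy₀.le) hlt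
    have hr' := hr.shift (j := 0) (k := n - 1) (by omega)
    refine ih (n - 1) (by omega) (by omega) _ hr' ?_
    obtain ⟨m, rfl⟩ : ∃ m, n = m + 2 := ⟨n - 2, by omega⟩
    simp [seqCons, show m + 2 - (1 + m) = 1 by omega]
  have hlt₁ := aux x h h₀ hc
  have hlt₂ := aux _ h.reverse (by simpa using h₁) (by simpa using hc.symm)
  simp only [Nat.sub_sub_self (show 1 ≤ n by omega)] at hlt₂
  have hne : x 1 ≠ x (n - 1) := by
    have := ih (n - 2) (by omega) (by omega) _ (h.shift (j := 1) (k := n - 2) (by omega))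
    rwa [show 1 + (n - 2) = n - 1 by omega] at this
  set u := x 1 ⊓ x (n - 1) with hu
  have hu₁ : u < x 1 := inf_le_left.lt_of_ne fun e =>
    hlt₁ ((inf_eq_left.1 e).lt_of_ne hne)
  have hu₂ : u < x (n - 1) := inf_le_right.lt_of_ne fun e =>
    hlt₂ ((inf_eq_right.1 e).lt_of_ne hne.symm)
  have hu₀ : x 0 ≤ u := le_inf h₀.le (hc.trans_lt h₁).le
  obtain ⟨m, rfl⟩ : ∃ m, n = m + 3 := ⟨n - 3, by omega⟩
  have hy := h.raise_head (d := u) (by omega) hu₀ hu₁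
  have hz := hy.reverse.raise_head (d := u) (by omega)
    (by simpa [seqCons, Nat.add_comm 1, ← hc] using hu₀)
    (by simpa [seqCons, Nat.add_comm 1] using hu₂)
  refine hV.not_isTurn hz (by omega) ?_ ?_ ?_
  · by_contra hodd
    have := (h.lt_succ_iff_even h₀ (m + 2) (by omega)).2 (by grind)
    exact this.not_gt h₁
  · simp [seqCons, show m + 3 - (1 + (m + 2)) = 0 by omega]
  · refine Or.inl ⟨?_, ?_, ?_⟩
    · simpa [seqCons, show m + 3 - (1 + (m + 1)) = 1 by omega] using hu₁
    · simpa [seqCons, Nat.add_comm 1] using hu₂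
    · simpa [seqCons, Nat.add_comm 1, show m + 3 - (1 + (m + 1)) = 1 by omega] using hu

/-- Inductive step for `SimplyConnected.not_closed`: the base point lies strictly between its
neighbours. -/
theorem not_closed_of_monotone_at_base (h : IsZigzag x n)
    (hn : 2 ≤ n) (hc : x 0 = x n)
    (ih : ∀ m, 1 ≤ m → m < n → ∀ y : ℕ → V, IsZigzag y m → y 0 ≠ y m)
    (h₀ : x 0 < x 1) (h₁ : x (n - 1) < x n) : False := by
  have hn2 : n ≠ 2 := by
    rintro rfl
    exact h₀.not_gt (hc ▸ h₁)
  have t₁ := h.turn (i := 0) hn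
  have h₂ : x 2 < x 1 := t₁.right_lt h₀
  have hn3 : n ≠ 3 := by
    rintro rfl
    have := t₁.eq_sup h₀
    simp only [Nat.zero_add] at this
    rw [sup_eq_left.2 (hc ▸ h₁.le)] at this
    exact h₀.ne' this
  have t₂ := h.turn (i := 1) (by omega)
  have h₃ : ¬ x 3 ≤ x 1 := fun h3 => by
    have := t₂.eq_inf h₂
    rw [inf_eq_right.2 h3] at this
    exact (t₂.lt_right h₂).ne this
  have hlast : 4 ≤ n - 1 ∧ x (n - 1) ≤ x 1 := by
    have hle := h₁.le.trans (hc ▸ h₀.le)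
    refine ⟨?_, hle⟩
    by_contra hlt
    obtain rfl : n = 4 := by omega
    exact h₃ hle
  have hex : ∃ j, 4 ≤ j ∧ x j ≤ x 1 := ⟨n - 1, hlast⟩
  classical
  obtain ⟨hj4, hj⟩ := Nat.find_spec hex
  have hjn : Nat.find hex ≤ n - 1 := Nat.find_min' hex hlast
  have hmin : ¬ x (Nat.find hex - 1) ≤ x 1 := by
    intro hle
    rcases Nat.lt_or_ge (Nat.find hex) 5 with h5 | h5
    · rw [show Nat.find hex = 4 by omega] at hle
      exact h₃ hle
    · exact Nat.find_min hex (m := Nat.find hex - 1) (by omega) ⟨by omega, hle⟩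
  generalize Nat.find hex = j at hj4 hj hjn hmin
  obtain ⟨k, rfl⟩ : ∃ k, j = k + 4 := ⟨j - 4, by omega⟩
  simp only [show k + 4 - 1 = k + 3 by omega] at hmin
  have hjlt : x (k + 4) < x (k + 3) :=
    (h.step (i := k + 3) (by omega)).resolve_left fun hl => hmin (hl.le.trans hj)
  set u := x (k + 3) ⊓ x 1 with hu
  have hu_lt : u < x (k + 3) := inf_le_left.lt_of_ne fun e => hmin (inf_eq_left.1 e)
  have hle_u : x (k + 4) ≤ u := le_inf hjlt.le hj
  have hy := (h.shift (j := 2) (k := k + 2) (by omega)).reverse.raise_head (d := u) (by omega)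
    (by simpa [Nat.add_comm 2] using hle_u)
    (by simpa [show 2 + (k + 1) = k + 3 by omega] using hu_lt)
  obtain ⟨y, hy, y₀, y₁, y₂, y₃⟩ : ∃ y : ℕ → V, IsZigzag y (k + 2) ∧ y 0 = u ∧
      y 1 = x (k + 3) ∧ y (k + 1) = x 3 ∧ y (k + 2) = x 2 := by
    refine ⟨_, hy, rfl, ?_, ?_, ?_⟩
    · simp [seqCons, show 2 + (k + 1) = k + 3 by omega]
    · simp [seqCons, show 2 + (k + 2 - (1 + k)) = 3 by omega]
    · simp [seqCons, show 2 + (k + 2 - (1 + (k + 1))) = 2 by omega]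
  set v := x 2 ⊔ u with hv
  have hv₁ : v ≤ x 1 := sup_le h₂.le inf_le_right
  have hvu : u ≠ v → IsTurn v (y 0) (y 1) := fun hne => by
    rw [y₀, y₁]
    refine Or.inl ⟨lt_of_le_of_ne le_sup_right hne, hu_lt, le_antisymm ?_ ?_⟩
    · exact le_inf le_sup_right hu_lt.le
    · rw [hu, inf_comm (x (k + 3))]
      exact inf_le_inf_right _ hv₁
  have hvx : x 2 ≠ v → IsTurn v (x 2) (x 3) := fun hne => by
    have h23 : x 2 < x 3 := t₂.lt_right h₂
    refine Or.inl ⟨lt_of_le_of_ne le_sup_left hne, h23, le_antisymm ?_ ?_⟩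
    · exact le_inf le_sup_left h23.le
    · conv_rhs => rw [show x 2 = x 1 ⊓ x 3 from t₂.eq_inf h₂]
      exact inf_le_inf_right _ hv₁
  obtain ⟨z, m, hm, hmn, hz, z₀, z₁, z₂⟩ : ∃ (z : ℕ → V) (m : ℕ), 2 ≤ m ∧ m < n - 1 ∧
      IsZigzag z m ∧ z 0 = v ∧ z (m - 1) = x 3 ∧ z m = x 2 := by
    by_cases hne : u = v
    · exact ⟨y, k + 2, by omega, by omega, hy, y₀.trans hne, y₂, y₃⟩
    · refine ⟨_, k + 3, by omega, by omega,
        hy.cons (a := v) (Or.inr ?_) fun _ => hvu hne, rfl, y₂, y₃⟩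
      rw [y₀]
      exact lt_of_le_of_ne le_sup_right hne
  by_cases hne : x 2 = v
  · exact ih m (by omega) (by omega) z hz (by rw [z₀, z₂, hne])
  · refine ih (m + 1) (by omega) (by omega) _ (hz.reverse.cons (a := v) (Or.inr ?_) fun _ => ?_) ?_
    · simp only [Nat.sub_zero, z₂]
      exact lt_of_le_of_ne le_sup_left hne
    · simpa only [Nat.sub_zero, z₂, z₁] using hvx hne
    · simp [seqCons, z₀]

open OrderDual in
/-- A simply connected lattice has no closed zigzags at all. -/
theorem SimplyConnected.not_closed (hV : SimplyConnected V) (hn : 1 ≤ n) (h : IsZigzag x n) :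
    x 0 ≠ x n := by
  induction n using Nat.strong_induction_on generalizing x with
  | _ n ih =>
    intro hc
    have ih' : ∀ m, 1 ≤ m → m < n → ∀ y : ℕ → V, IsZigzag y m → y 0 ≠ y m :=
      fun m hm hmn y hy => ih m hmn hm hy
    have ihd : ∀ m, 1 ≤ m → m < n → ∀ y : ℕ → Vᵒᵈ, IsZigzag y m → y 0 ≠ y m :=
      fun m hm hmn y hy he => ih m hmn hm (x := fun i => ofDual (y i)) hy.dual he
    obtain ⟨m, rfl⟩ : ∃ m, n = m + 1 := ⟨n - 1, by omega⟩
    have hm : m ≠ 0 := by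
      rintro rfl
      rcases h.step (i := 0) one_pos with h' | h'
      · exact h'.ne hc
      · exact h'.ne' hc
    rcases h.step (i := 0) (by omega) with h₀ | h₀ <;>
      rcases h.step (i := m) (by omega) with h₁ | h₁
    · exact not_closed_of_monotone_at_base h (by omega) hc ih' h₀ h₁
    · exact hV.not_closed_turn h (by omega) hc ih' h₀ h₁
    · exact hV.dual.not_closed_turn h.dual (by omega) hc ihd h₀ h₁
    · exact not_closed_of_monotone_at_base h.dual (by omega) hc ihd h₀ h₁

end Zigzag

section Closed

variable {M : Type*} [Lattice M] {A : Set M} {x : ℕ → M} {n : ℕ}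

/-- A zigzag that meets `A` exactly in its last term. -/
def IsPathTo (x : ℕ → M) (n : ℕ) (A : Set M) : Prop :=
  IsZigzag x n ∧ (∀ i < n, x i ∉ A) ∧ x n ∈ A

theorem IsPathTo.shift (h : IsPathTo x n A) {j : ℕ} (hj : j ≤ n) :
    IsPathTo (fun i => x (j + i)) (n - j) A :=
  ⟨h.1.shift (by omega), fun i hi => h.2.1 _ (by omega), by
    simpa only [Nat.add_sub_cancel' hj] using h.2.2⟩

theorem IsPathTo.dual (h : IsPathTo x n A) :
    IsPathTo (M := Mᵒᵈ) (fun i => OrderDual.toDual (x i)) n (OrderDual.ofDual ⁻¹' A) :=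
  ⟨h.1.dual, h.2⟩

variable [BoundedOrder M]

open OrderDual in
theorem ZClosed.dual (hA : ZClosed A) : ZClosed (M := Mᵒᵈ) (ofDual ⁻¹' A) :=
  ⟨hA.2.1, hA.1, fun y m hy h₀ h₁ i hi => hA.2.2 (fun i => ofDual (y i)) m hy.dual h₀ h₁ i hi⟩

theorem ZClosed.inf_mem (hA : ZClosed A) {a b : M} (ha : a ∈ A) (hb : b ∈ A) : a ⊓ b ∈ A := by
  by_cases h₁ : a ⊓ b = a
  · rwa [h₁]
  by_cases h₂ : a ⊓ b = b
  · rwa [h₂]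
  have ha' : a ⊓ b < a := lt_of_le_of_ne inf_le_left h₁
  have hb' : a ⊓ b < b := lt_of_le_of_ne inf_le_right h₂
  have hz : IsZigzag (fun _ : ℕ => b) 0 := ⟨fun i hi => by omega, fun i hi => by omega⟩
  have hz := (hz.cons (a := a ⊓ b) (Or.inl hb') (by omega)).cons (a := a) (Or.inr ha')
    fun _ => Or.inl ⟨ha', hb', rfl⟩
  exact hA.2.2 _ 2 hz ha hb 1 (by omega)

open OrderDual in
theorem ZClosed.sup_mem (hA : ZClosed A) {a b : M} (ha : a ∈ A) (hb : b ∈ A) : a ⊔ b ∈ A :=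
  hA.dual.inf_mem (a := toDual a) (b := toDual b) ha hb

theorem ZClosed.le_of_path (hA : ZClosed A) (h : IsPathTo x n A) (hn : 2 ≤ n) {c : M}
    (hc : c ∈ A) (h₀ : x 0 ≤ c) (h₁ : x 0 < x 1) : x 1 ≤ c := by
  by_contra hlt
  have hd : c ⊓ x 1 < x 1 := inf_le_right.lt_of_ne fun e => hlt (inf_eq_right.1 e)
  have hz := h.1.raise_head (by omega) (le_inf h₀ h₁.le) hd
  obtain ⟨m, rfl⟩ : ∃ m, n = m + 1 := ⟨n - 1, by omega⟩
  have hlast : x (1 + m) ∈ A := Nat.add_comm m 1 ▸ h.2.2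
  by_cases he : c ⊓ x 1 = c
  · exact h.2.1 1 (by omega) (hA.2.2 _ _ hz (by simpa [seqCons, he] using hc) hlast 1 (by omega))
  · have hdc : c ⊓ x 1 < c := lt_of_le_of_ne inf_le_left he
    have hz' := hz.cons (a := c) (Or.inr hdc) fun _ => Or.inl ⟨hdc, hd, rfl⟩
    exact h.2.1 1 (by omega) (hA.2.2 _ _ hz' hc hlast 2 (by omega))

/-- A path to a closed set `A` stays below any element of `A` above its start. -/
theorem ZClosed.path_le (hA : ZClosed A) (h : IsPathTo x n A) {q : M} (hq : q ∈ A)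
    (h₀ : x 0 ≤ q) : ∀ i < n, x i ≤ q := by
  intro i
  induction i with
  | zero => exact fun _ => h₀
  | succ i ih =>
    intro hi
    rcases h.1.step (i := i) (by omega) with hs | hs
    · exact hA.le_of_path (h.shift (j := i) (by omega)) (by omega) hq (ih (by omega)) hs
    · exact hs.le.trans (ih (by omega))

open OrderDual in
theorem ZClosed.le_path (hA : ZClosed A) (h : IsPathTo x n A) {p : M} (hp : p ∈ A)
    (h₀ : p ≤ x 0) : ∀ i < n, p ≤ x i :=
  hA.dual.path_le (q := toDual p) h.dual hp h₀

theorem ZClosed.exists_lt_of_sink (hA : ZClosed A) {a b c q : M} (ht : IsTurn a b c)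
    (hab : b < a) (hc : c ∈ A) (hq : q ∈ A) (haq : a ≤ q) : ∃ q' ∈ A, b ≤ q' ∧ q' < q := by
  refine ⟨q ⊓ c, hA.inf_mem hq hc, le_inf (hab.le.trans haq) (ht.lt_right hab).le,
    lt_of_le_of_ne inf_le_left fun e => ?_⟩
  have := ht.eq_inf hab
  rw [inf_eq_left.2 (haq.trans (inf_eq_left.1 e))] at this
  exact hab.ne this

open OrderDual in
theorem ZClosed.exists_lt_of_peak (hA : ZClosed A) {a b c p : M} (ht : IsTurn a b c)
    (hab : a < b) (hc : c ∈ A) (hp : p ∈ A) (hpa : p ≤ a) : ∃ p' ∈ A, p' ≤ b ∧ p < p' :=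
  hA.dual.exists_lt_of_sink (a := toDual a) (b := toDual b) (c := toDual c) (q := toDual p)
    (Or.symm ht) hab hc hp hpa

/-- If every path from `a` to `A` has length at most one, then `insert a A` is closed. -/
theorem ZClosed.insert (hM : SimplyConnected M) (hA : ZClosed A) {a : M}
    (hpath : ∀ (x : ℕ → M) (n : ℕ), 2 ≤ n → x 0 = a → ¬ IsPathTo x n A) :
    ZClosed (insert a A) := by
  refine ⟨Or.inr hA.1, Or.inr hA.2.1, fun x n hx h₀ hn i hi => ?_⟩
  by_contra hmem
  classical
  have hex : ∃ k, i + k ≤ n ∧ x (i + k) ∈ Insert.insert a A :=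
    ⟨n - i, by omega, by rwa [Nat.add_sub_cancel' hi]⟩
  have hex' : ∃ j, j ≤ i ∧ x (i - j) ∈ Insert.insert a A := ⟨i, le_rfl, by simpa using h₀⟩
  obtain ⟨hk, hkA⟩ := Nat.find_spec hex
  obtain ⟨hj, hjA⟩ := Nat.find_spec hex'
  have hkmin := fun m => Nat.find_min (m := m) hex
  have hjmin := fun m => Nat.find_min (m := m) hex'
  generalize Nat.find hex = k at hk hkA hkmin
  generalize Nat.find hex' = j at hj hjA hjmin
  have hk₀ : k ≠ 0 := by rintro rfl; exact hmem hkA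
  have hj₀ : j ≠ 0 := by rintro rfl; exact hmem hjA
  have hz := hx.shift (j := i - j) (k := j + k) (by omega)
  have hint : ∀ l, 0 < l → l < j + k → x (i - j + l) ∉ Insert.insert a A := by
    intro l hl₀ hl
    rcases Nat.lt_or_ge l j with hlj | hlj
    · rw [show i - j + l = i - (j - l) by omega]
      exact fun hm => hjmin (j - l) (by omega) ⟨by omega, hm⟩
    · rw [show i - j + l = i + (l - j) by omega]
      exact fun hm => hkmin (l - j) (by omega) ⟨by omega, hm⟩
  rw [show i + k = i - j + (j + k) by omega] at hkA
  have hinA : ∀ l, 0 < l → l < j + k → x (i - j + l) ∉ A :=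
    fun l hl₀ hl hm => hint l hl₀ hl (Or.inr hm)
  by_cases hj' : x (i - j) ∈ A
  · by_cases hk' : x (i - j + (j + k)) ∈ A
    · exact hinA j (by omega) (by omega)
        (hA.2.2 _ _ hz hj' hk' j (by omega))
    · refine hpath _ (j + k) (by omega) ?_ ⟨hz.reverse, fun l hl => ?_, ?_⟩
      · simpa using hkA.resolve_right hk'
      · rcases Nat.eq_zero_or_pos l with rfl | hl₀
        · exact hk'
        · exact hinA _ (by omega) (by omega)
      · simpa using hj'
  · have hja := hjA.resolve_right hj'
    by_cases hk' : x (i - j + (j + k)) ∈ A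
    · refine hpath _ (j + k) (by omega) hja ⟨hz, fun l hl => ?_, hk'⟩
      rcases Nat.eq_zero_or_pos l with rfl | hl₀
      · exact hj'
      · exact hinA _ hl₀ hl
    · exact hM.not_closed (by omega) hz (hja.trans (hkA.resolve_right hk').symm)

/-- Adding one element to a closed set lying in an interval of `A` of bounded width. -/
theorem ZClosed.exists_closed_insert (hM : SimplyConnected M) {layer : M → ℤ}
    (hl : StrictMono layer) (d : ℕ) (hA : ZClosed A) {a p q : M} (hp : p ∈ A) (hq : q ∈ A)
    (hpa : p ≤ a) (haq : a ≤ q) (hd : layer q - layer p ≤ d) :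
    ∃ B, ZClosed B ∧ A ⊆ B ∧ a ∈ B ∧ (B \ A).Finite := by
  induction d using Nat.strong_induction_on generalizing A a p q with
  | _ d ihd =>
  have narrow : ∀ (A : Set M) (a p q : M), ZClosed A → p ∈ A → q ∈ A → p ≤ a → a ≤ q →
      layer q - layer p < d → ∃ B, ZClosed B ∧ A ⊆ B ∧ a ∈ B ∧ (B \ A).Finite := by
    intro A a p q hA hp hq hpa haq hlt
    have := hl.monotone (hpa.trans haq)
    exact ihd (layer q - layer p).toNat (by omega) hA hp hq hpa haq (by omega)
  by_cases haA : a ∈ A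
  · exact ⟨A, hA, subset_rfl, haA, by simp⟩
  by_cases hpath : ∀ (x : ℕ → M) (n : ℕ), 2 ≤ n → x 0 = a → ¬ IsPathTo x n A
  · exact ⟨_, hA.insert hM hpath, Set.subset_insert _ _, Set.mem_insert _ _,
      (Set.finite_singleton a).subset fun y hy => hy.1.resolve_right hy.2⟩
  push Not at hpath
  obtain ⟨x, n, hn, hxa, hx⟩ := hpath
  induction n using Nat.strong_induction_on generalizing A with
  | _ n ihn =>
  subst hxa
  have hle := hA.path_le hx hq haq
  have hge := hA.le_path hx hp hpa
  obtain ⟨m, rfl⟩ : ∃ m, n = m + 2 := ⟨n - 2, by omega⟩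
  have ht := hx.1.turn (i := m) le_rfl
  obtain ⟨B, hB, hAB, hxB, hfin⟩ : ∃ B, ZClosed B ∧ A ⊆ B ∧ x (m + 1) ∈ B ∧ (B \ A).Finite := by
    rcases hx.1.step (i := m) (by omega) with hs | hs
    · obtain ⟨p', hp', hle', hlt'⟩ := hA.exists_lt_of_peak ht hs hx.2.2 hp (hge m (by omega))
      have := hl hlt'
      exact narrow A _ p' q hA hp' hq hle' (hle _ (by omega)) (by omega)
    · obtain ⟨q', hq', hle', hlt'⟩ := hA.exists_lt_of_sink ht hs hx.2.2 hq (hle m (by omega))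
      have := hl hlt'
      exact narrow A _ p q' hA hp hq' (hge _ (by omega)) hle' (by omega)
  suffices ∃ C, ZClosed C ∧ B ⊆ C ∧ x 0 ∈ C ∧ (C \ B).Finite by
    obtain ⟨C, hC, hBC, hxC, hfin'⟩ := this
    refine ⟨C, hC, hAB.trans hBC, hxC, (hfin'.union hfin).subset fun y hy => ?_⟩
    by_cases hyB : y ∈ B
    · exact Or.inr ⟨hyB, hy.2⟩
    · exact Or.inl ⟨hy.1, hyB⟩
  by_cases h₀ : x 0 ∈ B
  · exact ⟨B, hB, subset_rfl, h₀, by simp⟩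
  classical
  have hex : ∃ k, x k ∈ B := ⟨m + 1, hxB⟩
  have hk := Nat.find_spec hex
  have hkm : Nat.find hex ≤ m + 1 := Nat.find_min' hex hxB
  have hkmin := fun l => Nat.find_min (m := l) hex
  generalize Nat.find hex = k at hk hkm hkmin
  have hk₀ : k ≠ 0 := by rintro rfl; exact h₀ hk
  by_cases hk₁ : k = 1
  · subst hk₁
    have hxA := hx.2.1 1 (by omega)
    rcases hx.1.step (i := 0) (by omega) with hs | hs
    · have := hl (lt_of_le_of_ne (hle 1 (by omega)) fun e => hxA (e ▸ hq))
      exact narrow B _ p (x 1) hB (hAB hp) hk hpa hs.le (by omega)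
    · have := hl (lt_of_le_of_ne (hge 1 (by omega)) fun e => hxA (e ▸ hp))
      exact narrow B _ (x 1) q hB hk (hAB hq) hs.le haq (by omega)
  · have hz : IsZigzag x k := by simpa using hx.1.shift (j := 0) (k := k) (by omega)
    exact ihn k (by omega) hB (hAB hp) (hAB hq) h₀ (by omega) ⟨hz, hkmin, hk⟩

end Closed

theorem FreePseudospace.exists_closed_union {N : ℕ} {M : Type*} [Lattice M] [BoundedOrder M]
    (P : FreePseudospace N M) {A X : Set M} (hA : ZClosed A) (hX : X.Finite) :
    ∃ B, ZClosed B ∧ A ∪ X ⊆ B ∧ (B \ A).Finite := by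
  induction X, hX using Set.Finite.induction_on with
  | empty => exact ⟨A, hA, by simp, by simp⟩
  | @insert a X _ _ ih =>
    obtain ⟨B, hB, hAB, hfin⟩ := ih
    obtain ⟨C, hC, hBC, haC, hfin'⟩ := hB.exists_closed_insert P.simplyConnected
      (layer := P.layer) (fun v w h => P.layer_strictMono v w h) (N + 2) (a := a)
      hB.1 hB.2.1 bot_le le_top (by rw [P.layer_bot, P.layer_top]; push_cast; omega)
    refine ⟨C, hC, ?_, (hfin'.union hfin).subset fun y hy => ?_⟩
    · rw [Set.union_insert]
      exact Set.insert_subset haC (hAB.trans hBC)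
    · by_cases hyB : y ∈ B
      · exact Or.inr ⟨hyB, hy.2⟩
      · exact Or.inl ⟨hy.1, hyB⟩

/-- (Lemma 4.7) If `A` is closed and `X` is finite, then `cl(A ∪ X) \ A` is finite. -/
theorem zcl_union_finite_diff {N : ℕ} {M : Type*}
    [Lattice M] [BoundedOrder M] (P : FreePseudospace N M)
    (A : Set M) (hA : ZClosed A) (X : Set M) (hX : X.Finite) :
    (zcl (A ∪ X) \ A).Finite := by
  obtain ⟨B, hB, hAB, hfin⟩ := P.exists_closed_union hA hX
  exact hfin.subset (Set.sdiff_subset_sdiff_left (Set.sInter_subset_of_mem ⟨hB, hAB⟩))
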